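/- arXiv:2305.03940 — 5 statements merged into one kernel-verified Lean document; each statement's English description precedes it below -/
import Mathlib

section
/- Let n, t be positive integers, let π₁,…,π_t be nonnegative reals with Σ_{s=1}^t π_s = 1, and let α ≥ 0. Then the multinomial probability of the event Σ_{s=1}^t |Z_s − nπ_s| ≥ α√n is at most 2^t · e^{−α²/2}; explicitly, Σ over all (z₁,…,z_t) ∈ ℕ^t with z₁+⋯+z_t = n and Σ_{s=1}^t |z_s − nπ_s| ≥ α√n of (n!/(z₁!⋯z_t!)) · π₁^{z₁}⋯π_t^{z_t} ≤ 2^t · e^{−α²/2}. -/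
open Finset
open scoped Classical

/-- **Hoeffding's lemma** for a finitely supported distribution with weights `w` on `[0, 1]`. -/
theorem sum_mul_exp_sub_mean_le {ι : Type*} [Fintype ι] (w X : ι → ℝ) (hw0 : ∀ i, 0 ≤ w i)
    (hw1 : ∑ i, w i = 1) (hX : ∀ i, X i ∈ Set.Icc (0 : ℝ) 1) (c : ℝ) :
    ∑ i, w i * Real.exp (c * (X i - ∑ j, w j * X j)) ≤ Real.exp (c ^ 2 / 8) := by
  let _ : MeasurableSpace ι := ⊤
  let μ : MeasureTheory.Measure ι :=
    ∑ i, ENNReal.ofReal (w i) • MeasureTheory.Measure.dirac i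
  have hμ : MeasureTheory.IsProbabilityMeasure μ := by
    constructor
    simp [μ, ← ENNReal.ofReal_sum_of_nonneg fun i _ => hw0 i, hw1]
  have hint (f : ι → ℝ) : ∫ i, f i ∂μ = ∑ i, w i * f i := by
    rw [MeasureTheory.integral_finsetSum_measure fun i _ =>
      (MeasureTheory.integrable_dirac (by simp)).smul_measure ENNReal.ofReal_ne_top]
    simp [MeasureTheory.integral_smul_measure, hw0]
  have h := (ProbabilityTheory.hasSubgaussianMGF_of_mem_Icc (μ := μ) (X := X) (a := 0) (b := 1)
    Measurable.of_discrete.aemeasurable (Filter.Eventually.of_forall hX)).mgf_le c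
  simp only [ProbabilityTheory.mgf, hint] at h
  refine h.trans_eq ?_
  congr 1
  simp
  ring

/-- If the entries of `x` sum to zero, the subset of nonnegative entries carries half of the
`ℓ¹` norm. -/
theorem exists_sum_eq_half_sum_abs {ι : Type*} [Fintype ι] (x : ι → ℝ) (hx : ∑ i, x i = 0) :
    ∃ A : Finset ι, ∑ i ∈ A, x i = (∑ i, |x i|) / 2 := by
  refine ⟨univ.filter fun i => 0 ≤ x i, ?_⟩
  have h : ∑ i, |x i| = ∑ i, (2 * (if 0 ≤ x i then x i else 0) - x i) := by
    refine sum_congr rfl fun i _ => ?_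
    split_ifs with hi
    · rw [abs_of_nonneg hi]; ring
    · rw [abs_of_neg (not_le.mp hi)]; ring
  rw [h, sum_sub_distrib, hx, ← mul_sum, sum_filter]
  ring

/-- The moment generating function bound for the centred multinomial count of a subset `A`. -/
theorem sum_multinomial_mul_exp_le {ι : Type*} [Fintype ι] [DecidableEq ι] (w : ι → ℝ) (hw0 : ∀ i, 0 ≤ w i)
    (hw1 : ∑ i, w i = 1) (n : ℕ) (A : Finset ι) (c : ℝ) :
    ∑ z ∈ piAntidiag (univ : Finset ι) n, (Nat.multinomial univ z * ∏ i, w i ^ z i) *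
      Real.exp (c * ∑ i ∈ A, ((z i : ℝ) - n * w i)) ≤ Real.exp (n * (c ^ 2 / 8)) := by
  let X : ι → ℝ := fun i => if i ∈ A then 1 else 0
  have hm : ∑ j, w j * X j = ∑ j ∈ A, w j := by simp [X]
  have hX (i : ι) : X i ∈ Set.Icc (0 : ℝ) 1 := by
    by_cases hi : i ∈ A <;> simp [X, hi]
  have key := sum_mul_exp_sub_mean_le w X hw0 hw1 hX c
  have hpow := pow_le_pow_left₀
    (sum_nonneg fun i _ => mul_nonneg (hw0 i) (Real.exp_nonneg _)) key n
  rw [← Real.exp_nat_mul, sum_pow_eq_sum_piAntidiag] at hpow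
  refine le_of_eq_of_le (sum_congr rfl fun z hz => ?_) hpow
  have hz : (∑ i, (z i : ℝ)) = n := by
    exact_mod_cast (mem_piAntidiag.mp hz).1
  simp only [mul_pow, prod_mul_distrib, ← Real.exp_nat_mul, ← Real.exp_sum]
  rw [mul_assoc]
  congr 3
  have hA : ∑ i, (z i : ℝ) * X i = ∑ i ∈ A, (z i : ℝ) := by simp [X]
  calc c * ∑ i ∈ A, ((z i : ℝ) - n * w i)
      = c * (∑ i, (z i : ℝ) * X i - (∑ i, (z i : ℝ)) * ∑ j, w j * X j) := by
        rw [hA, hz, hm, sum_sub_distrib, mul_sum]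
    _ = ∑ i, (z i : ℝ) * (c * (X i - ∑ j, w j * X j)) := by
        rw [sum_mul, ← sum_sub_distrib, mul_sum]
        exact sum_congr rfl fun i _ => by ring

/-- Bretagnolle–Huber–Carol inequality: for a multinomial distribution with
parameters `n` and `(π₁, …, π_t)`, the probability that
`Σ_s |Z_s − n π_s| ≥ α √n` is at most `2^t e^{−α²/2}`. -/
theorem stmt1 (n t : ℕ) (hn : 0 < n) (ht : 0 < t) (π : Fin t → ℝ)
    (hπ0 : ∀ s, 0 ≤ π s) (hπ1 : ∑ s, π s = 1) (α : ℝ) (hα : 0 ≤ α) :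
    ∑ z ∈ (Fintype.piFinset fun _ : Fin t => Finset.range (n + 1)).filter
        (fun z => (∑ s, z s) = n ∧ α * Real.sqrt n ≤ ∑ s, |(z s : ℝ) - n * π s|),
      (n.factorial : ℝ) / (∏ s, ((z s).factorial : ℝ)) * ∏ s, π s ^ z s
      ≤ 2 ^ t * Real.exp (-(α ^ 2) / 2) := by
  have hn' : (0 : ℝ) < n := by exact_mod_cast hn
  have hs : 0 < Real.sqrt n := Real.sqrt_pos.mpr hn'
  have hsq : Real.sqrt n ^ 2 = n := Real.sq_sqrt hn'.le
  set c : ℝ := 2 * α / Real.sqrt n with hc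
  have hc0 : 0 ≤ c := by positivity
  have hcs : c * (α * Real.sqrt n / 2) = α ^ 2 := by rw [hc]; field_simp
  have hcn : n * (c ^ 2 / 8) = α ^ 2 / 2 := by rw [hc, div_pow, hsq]; field_simp; ring
  let P : (Fin t → ℕ) → ℝ := fun z => Nat.multinomial univ z * ∏ s, π s ^ z s
  have hP (z : Fin t → ℕ) : 0 ≤ P z :=
    mul_nonneg (Nat.cast_nonneg _) (prod_nonneg fun s _ => pow_nonneg (hπ0 s) _)
  let E : Finset (Fin t) → (Fin t → ℕ) → ℝ := fun A z =>
    Real.exp (c * ∑ s ∈ A, ((z s : ℝ) - n * π s))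
  have hE (z : Fin t → ℕ) : 0 ≤ ∑ A, E A z := sum_nonneg fun A _ => Real.exp_nonneg _
  calc _ ≤ ∑ z ∈ (Fintype.piFinset fun _ : Fin t => Finset.range (n + 1)).filter
        (fun z => (∑ s, z s) = n ∧ α * Real.sqrt n ≤ ∑ s, |(z s : ℝ) - n * π s|),
          P z * (Real.exp (-α ^ 2) * ∑ A, E A z) := by
        refine sum_le_sum fun z hz => ?_
        obtain ⟨-, hzn, hza⟩ := mem_filter.mp hz
        have hmult : (n.factorial : ℝ) / ∏ s, ((z s).factorial : ℝ) =
            Nat.multinomial univ z := by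
          rw [div_eq_iff (by positivity), mul_comm, ← hzn]
          exact_mod_cast (Nat.multinomial_spec univ z).symm
        rw [hmult]
        refine le_mul_of_one_le_right (hP z) ?_
        have hzero : ∑ s, ((z s : ℝ) - n * π s) = 0 := by
          rw [sum_sub_distrib, ← mul_sum, hπ1, ← hzn]
          simp
        obtain ⟨A, hA⟩ := exists_sum_eq_half_sum_abs _ hzero
        have hEA : Real.exp (α ^ 2) ≤ E A z := by
          refine Real.exp_le_exp.mpr ?_
          rw [hA, ← hcs]
          gcongr
        calc (1 : ℝ) = Real.exp (-α ^ 2) * Real.exp (α ^ 2) := by simp [← Real.exp_add]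
          _ ≤ _ := by
            gcongr
            exact hEA.trans
              (single_le_sum (f := fun A => E A z) (fun B _ => Real.exp_nonneg _) (mem_univ A))
    _ ≤ ∑ z ∈ piAntidiag (univ : Finset (Fin t)) n,
          P z * (Real.exp (-α ^ 2) * ∑ A, E A z) := by
        refine sum_le_sum_of_subset_of_nonneg (fun z hz => ?_) fun z _ _ =>
          mul_nonneg (hP z) (mul_nonneg (Real.exp_nonneg _) (hE z))
        simpa using (mem_filter.mp hz).2.1
    _ = Real.exp (-α ^ 2) * ∑ A, ∑ z ∈ piAntidiag (univ : Finset (Fin t)) n, P z * E A z := by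
        rw [sum_comm, mul_sum]
        refine sum_congr rfl fun z _ => ?_
        rw [← mul_sum]
        ring
    _ ≤ Real.exp (-α ^ 2) * ∑ _A : Finset (Fin t), Real.exp (α ^ 2 / 2) := by
        refine mul_le_mul_of_nonneg_left (sum_le_sum fun A _ => ?_) (Real.exp_nonneg _)
        rw [← hcn]
        exact sum_multinomial_mul_exp_le π hπ0 hπ1 n A c
    _ = 2 ^ t * Real.exp (-(α ^ 2) / 2) := by
        rw [sum_const, card_univ, Fintype.card_finset, Fintype.card_fin, nsmul_eq_mul,
          mul_left_comm, ← Real.exp_add]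
        push_cast
        congr 2
        ring
end

section
/- For every n ∈ ℕ and j ∈ {1,2,3}^n, the operator Σ_{x ∈ {0,1}^n} 2^{−2n}·(ρ^E_{j,x})² is diagonal in the product basis {|g⟩ : g ∈ {0,1,2,3}^n}, namely Σ_{x ∈ {0,1}^n} 2^{−2n}·(ρ^E_{j,x})² = Σ_{g ∈ {0,1,2,3}^n} λ_g(j)·|g⟩⟨g|, with λ_g(j) = 2^{−n}·((1−γ)(1−(3/2)γ))^{t₀(g)} · ((γ/2)(1−γ))^{t_eq(g,j)} · (γ²/2)^{t₊₁(g,j)+t₊₂(g,j)}. -/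
open Matrix Finset

noncomputable section

/-- The basis index in `{1,2,3} ⊂ Fin 4` associated to `j : Fin 3`
(`j` enumerates the three bases `1,2,3`; addition in `Fin 3` is the
cyclic addition within `{1,2,3}`). -/
def idx (j : Fin 3) : Fin 4 := ⟨(j : ℕ) + 1, by omega⟩

/-- The 'no-error' state `|E^j_{x,x̄}⟩ = (1−γ)^{-1/2} (√(1−(3/2)γ)|0⟩ + (−1)^x √(γ/2)|j⟩)`. -/
def EvecNE (γ : ℝ) (j : Fin 3) (x : Fin 2) : Fin 4 → ℂ := fun i =>
  (Real.sqrt (1 - γ) : ℂ)⁻¹ *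
    ((Real.sqrt (1 - 3 / 2 * γ) : ℂ) * (if i = 0 then 1 else 0)
      + (-1 : ℂ) ^ (x : ℕ) * (Real.sqrt (γ / 2) : ℂ) * (if i = idx j then 1 else 0))

/-- The 'error' state `|E^j_{x,x}⟩ = 2^{-1/2} (|j+1⟩ + i (−1)^{x+1} |j+2⟩)`. -/
def EvecE (j : Fin 3) (x : Fin 2) : Fin 4 → ℂ := fun i =>
  (Real.sqrt 2 : ℂ)⁻¹ *
    ((if i = idx (j + 1) then 1 else 0)
      + Complex.I * (-1 : ℂ) ^ ((x : ℕ) + 1) * (if i = idx (j + 2) then 1 else 0))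

/-- Eve's post-measurement state `σ^j_{x,y} = |E^j_{x,y}⟩⟨E^j_{x,y}|`. -/
def sigmaE (γ : ℝ) (j : Fin 3) (x y : Fin 2) : Matrix (Fin 4) (Fin 4) ℂ :=
  if x = y then vecMulVec (EvecE j x) (star (EvecE j x))
  else vecMulVec (EvecNE γ j x) (star (EvecNE γ j x))

end

noncomputable section

/-- The `n`-fold tensor product `⊗_{i=1}^n M_i` of `4×4` matrices, realised as a
matrix indexed by the product basis `Fin n → Fin 4`. -/
def tensorPow {n : ℕ} (M : Fin n → Matrix (Fin 4) (Fin 4) ℂ) :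
    Matrix (Fin n → Fin 4) (Fin n → Fin 4) ℂ :=
  Matrix.of fun g g' => ∏ i, M i (g i) (g' i)

/-- Eve's state `ρ^E_{j,x} = ⊗_{i=1}^n ((1−γ)·σ^{j_i}_{x_i,x̄_i} + γ·σ^{j_i}_{x_i,x_i})`;
note that the bit flip `x̄_i` is `x_i + 1` in `Fin 2`. -/
def rhoE (γ : ℝ) {n : ℕ} (j : Fin n → Fin 3) (x : Fin n → Fin 2) :
    Matrix (Fin n → Fin 4) (Fin n → Fin 4) ℂ :=
  tensorPow fun i =>
    ((1 - γ : ℝ) : ℂ) • sigmaE γ (j i) (x i) (x i + 1)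
      + ((γ : ℝ) : ℂ) • sigmaE γ (j i) (x i) (x i)

end

/-- `t₀(g)`: the number of positions where `g` is `0`. -/
def tally0 {n : ℕ} (g : Fin n → Fin 4) : ℕ :=
  (Finset.univ.filter fun i => g i = 0).card

/-- `t_eq(g,j)`: the number of positions where `g_i = j_i`. -/
def tallyEq {n : ℕ} (g : Fin n → Fin 4) (j : Fin n → Fin 3) : ℕ :=
  (Finset.univ.filter fun i => g i = idx (j i)).card

/-- `t₊₁(g,j)`: the number of positions where `g_i = j_i + 1` (cyclic in `{1,2,3}`). -/
def tallyP1 {n : ℕ} (g : Fin n → Fin 4) (j : Fin n → Fin 3) : ℕ :=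
  (Finset.univ.filter fun i => g i = idx (j i + 1)).card

/-- `t₊₂(g,j)`: the number of positions where `g_i = j_i + 2` (cyclic in `{1,2,3}`). -/
def tallyP2 {n : ℕ} (g : Fin n → Fin 4) (j : Fin n → Fin 3) : ℕ :=
  (Finset.univ.filter fun i => g i = idx (j i + 2)).card

/-- The eigenvalue `λ_g(j)` of `Σ_x p_x² (ρ^E_{j,x})²`. -/
noncomputable def lam (γ : ℝ) {n : ℕ} (g : Fin n → Fin 4) (j : Fin n → Fin 3) : ℝ :=
  (1 / 2 : ℝ) ^ n * ((1 - γ) * (1 - 3 / 2 * γ)) ^ tally0 g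
    * ((γ / 2) * (1 - γ)) ^ tallyEq g j
    * (γ ^ 2 / 2) ^ (tallyP1 g j + tallyP2 g j)

theorem idx_zero : idx 0 = 1 := rfl

theorem idx_one : idx 1 = 2 := rfl

theorem idx_two : idx 2 = 3 := rfl

theorem tensorPow_mul {n : ℕ} (M N : Fin n → Matrix (Fin 4) (Fin 4) ℂ) :
    tensorPow M * tensorPow N = tensorPow fun i => M i * N i := by
  ext g g'
  simp only [tensorPow, Matrix.mul_apply, Matrix.of_apply, ← Finset.prod_mul_distrib]
  exact (Fintype.prod_sum fun i k => M i (g i) k * N i k (g' i)).symm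

theorem sum_tensorPow {n : ℕ} {κ : Type*} [Fintype κ]
    (M : Fin n → κ → Matrix (Fin 4) (Fin 4) ℂ) :
    ∑ x : Fin n → κ, tensorPow (fun i => M i (x i)) = tensorPow fun i => ∑ y, M i y := by
  ext g g'
  simp only [tensorPow, Matrix.sum_apply, Matrix.of_apply]
  exact (Fintype.prod_sum fun i k => M i k (g i) (g' i)).symm

theorem tensorPow_smul {n : ℕ} (c : ℂ) (M : Fin n → Matrix (Fin 4) (Fin 4) ℂ) :
    tensorPow (fun i => c • M i) = c ^ n • tensorPow M := by
  ext g g'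
  simp [tensorPow, Finset.prod_mul_distrib]

theorem tensorPow_diagonal {n : ℕ} (d : Fin n → Fin 4 → ℂ) :
    tensorPow (fun i => Matrix.diagonal (d i)) =
      Matrix.diagonal fun g => ∏ i, d i (g i) := by
  ext g g'
  simp only [tensorPow, Matrix.of_apply]
  by_cases h : g = g'
  · subst h
    simp
  · obtain ⟨i, hi⟩ := Function.ne_iff.mp h
    rw [Matrix.diagonal_apply_ne _ h]
    exact Finset.prod_eq_zero (Finset.mem_univ i) (Matrix.diagonal_apply_ne _ hi)

/-- The single-site eigenvalue, so that `lam` is its product over all sites. -/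
noncomputable def siteLam (γ : ℝ) (j : Fin 3) (a : Fin 4) : ℝ :=
  1 / 2 * (if a = 0 then (1 - γ) * (1 - 3 / 2 * γ) else 1)
    * (if a = idx j then (γ / 2) * (1 - γ) else 1)
    * ((if a = idx (j + 1) then γ ^ 2 / 2 else 1) * (if a = idx (j + 2) then γ ^ 2 / 2 else 1))

theorem lam_eq_prod_siteLam (γ : ℝ) {n : ℕ} (g : Fin n → Fin 4) (j : Fin n → Fin 3) :
    lam γ g j = ∏ i, siteLam γ (j i) (g i) := by
  simp only [lam, siteLam, tally0, tallyEq, tallyP1, tallyP2, Finset.prod_mul_distrib,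
    Finset.prod_ite, Finset.prod_const_one, Finset.prod_const, mul_one, pow_add,
    Finset.card_univ, Fintype.card_fin, mul_pow]

theorem ofReal_sqrt_mul_self {r : ℝ} (hr : 0 ≤ r) :
    ((Real.sqrt r : ℝ) : ℂ) * ((Real.sqrt r : ℝ) : ℂ) = r := by
  rw [← Complex.ofReal_mul, Real.mul_self_sqrt hr]

theorem inv_ofReal_sqrt_mul_self {r : ℝ} (hr : 0 ≤ r) :
    ((Real.sqrt r : ℝ) : ℂ)⁻¹ * ((Real.sqrt r : ℝ) : ℂ)⁻¹ = (r : ℂ)⁻¹ := by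
  rw [← mul_inv, ofReal_sqrt_mul_self hr]

theorem inv_sqrt_two_mul_self : ((Real.sqrt 2 : ℝ) : ℂ)⁻¹ * ((Real.sqrt 2 : ℝ) : ℂ)⁻¹ = 1 / 2 := by
  rw [inv_ofReal_sqrt_mul_self zero_le_two]
  norm_num

theorem EvecE_dotProduct_self (j : Fin 3) (x : Fin 2) :
    star (EvecE j x) ⬝ᵥ EvecE j x = 1 := by
  fin_cases j <;> fin_cases x <;>
    simp [dotProduct, Fin.sum_univ_four, EvecE, idx_zero, idx_one, idx_two] <;>
    linear_combination
      (2 : ℂ) * inv_sqrt_two_mul_self - ((Real.sqrt 2 : ℝ) : ℂ)⁻¹ ^ 2 * Complex.I_sq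

theorem inv_sqrt_mul_sqrt_mul_self {r t : ℝ} (hr : 0 ≤ r) (ht : 0 ≤ t) :
    ((Real.sqrt r : ℝ) : ℂ)⁻¹ * ((Real.sqrt t : ℝ) : ℂ) *
      (((Real.sqrt r : ℝ) : ℂ)⁻¹ * ((Real.sqrt t : ℝ) : ℂ)) = t / r := by
  rw [mul_mul_mul_comm, inv_ofReal_sqrt_mul_self hr, ofReal_sqrt_mul_self ht]
  ring

theorem EvecNE_dotProduct_self {γ : ℝ} (hγ0 : 0 ≤ γ) (hγ1 : γ ≤ 2 / 3) (j : Fin 3) (x : Fin 2) :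
    star (EvecNE γ j x) ⬝ᵥ EvecNE γ j x = 1 := by
  have hp := inv_sqrt_mul_sqrt_mul_self (by linarith : 0 ≤ 1 - γ)
    (by linarith : 0 ≤ 1 - 3 / 2 * γ)
  have hq := inv_sqrt_mul_sqrt_mul_self (by linarith : 0 ≤ 1 - γ) (by linarith : 0 ≤ γ / 2)
  have h0 : (1 - γ : ℂ) ≠ 0 := by
    exact_mod_cast (by linarith : 1 - γ ≠ 0)
  push_cast at hp hq
  fin_cases j <;> fin_cases x <;>
    simp [dotProduct, Fin.sum_univ_four, EvecNE, idx_zero, idx_one, idx_two, -Real.sqrt_div',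
      hp, hq] <;>
    field_simp <;> ring

theorem EvecNE_dotProduct_EvecE (γ : ℝ) (j : Fin 3) (x : Fin 2) :
    star (EvecNE γ j x) ⬝ᵥ EvecE j x = 0 := by
  fin_cases j <;> simp [dotProduct, Fin.sum_univ_four, EvecE, EvecNE, idx_zero, idx_one, idx_two]

theorem EvecE_dotProduct_EvecNE (γ : ℝ) (j : Fin 3) (x : Fin 2) :
    star (EvecE j x) ⬝ᵥ EvecNE γ j x = 0 := by
  fin_cases j <;> simp [dotProduct, Fin.sum_univ_four, EvecE, EvecNE, idx_zero, idx_one, idx_two]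

theorem smul_add_smul_vecMulVec_mul_self {ι : Type*} [Fintype ι] (c d : ℂ) {u v : ι → ℂ}
    (hu : star u ⬝ᵥ u = 1) (hv : star v ⬝ᵥ v = 1)
    (huv : star u ⬝ᵥ v = 0) (hvu : star v ⬝ᵥ u = 0) :
    (c • vecMulVec u (star u) + d • vecMulVec v (star v)) *
        (c • vecMulVec u (star u) + d • vecMulVec v (star v)) =
      c ^ 2 • vecMulVec u (star u) + d ^ 2 • vecMulVec v (star v) := by
  simp [mul_add, add_mul, Matrix.vecMulVec_mul_vecMulVec, hu, hv, huv, hvu, smul_smul, sq]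

theorem sum_vecMulVec_EvecNE {γ : ℝ} (hγ0 : 0 ≤ γ) (hγ1 : γ ≤ 2 / 3) (j : Fin 3) :
    ∑ x, ((1 - γ : ℝ) : ℂ) • vecMulVec (EvecNE γ j x) (star (EvecNE γ j x)) =
      Matrix.diagonal fun a =>
        (if a = 0 then 2 * ((1 - 3 / 2 * γ : ℝ) : ℂ) else 0) + if a = idx j then (γ : ℂ) else 0 := by
  have hp := inv_sqrt_mul_sqrt_mul_self (by linarith : 0 ≤ 1 - γ)
    (by linarith : 0 ≤ 1 - 3 / 2 * γ)
  have hq := inv_sqrt_mul_sqrt_mul_self (by linarith : 0 ≤ 1 - γ) (by linarith : 0 ≤ γ / 2)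
  have h0 : (1 - γ : ℂ) ≠ 0 := by
    exact_mod_cast (by linarith : 1 - γ ≠ 0)
  push_cast at hp hq
  ext a b
  fin_cases j <;> fin_cases a <;> fin_cases b <;>
    simp [vecMulVec_apply, EvecNE, idx_zero, idx_one, idx_two, -Real.sqrt_div',
      hp, hq] <;>
    field_simp <;> ring

theorem sum_vecMulVec_EvecE (j : Fin 3) :
    ∑ x, vecMulVec (EvecE j x) (star (EvecE j x)) =
      Matrix.diagonal fun a =>
        (if a = idx (j + 1) then (1 : ℂ) else 0) + if a = idx (j + 2) then 1 else 0 := by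
  ext a b
  fin_cases j <;> fin_cases a <;> fin_cases b <;>
    simp [vecMulVec_apply, EvecE, idx_zero, idx_one, idx_two] <;>
    first
    | linear_combination (2 : ℂ) * inv_sqrt_two_mul_self
    | linear_combination
        (2 : ℂ) * inv_sqrt_two_mul_self - 2 * ((Real.sqrt 2 : ℝ) : ℂ)⁻¹ ^ 2 * Complex.I_sq

/-- The single-site factor of `rhoE`. -/
noncomputable def siteRho (γ : ℝ) (j : Fin 3) (x : Fin 2) : Matrix (Fin 4) (Fin 4) ℂ :=
  ((1 - γ : ℝ) : ℂ) • sigmaE γ j x (x + 1) + ((γ : ℝ) : ℂ) • sigmaE γ j x x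

theorem siteRho_mul_self {γ : ℝ} (hγ0 : 0 ≤ γ) (hγ1 : γ ≤ 2 / 3) (j : Fin 3) (x : Fin 2) :
    siteRho γ j x * siteRho γ j x =
      ((1 - γ : ℝ) : ℂ) ^ 2 • vecMulVec (EvecNE γ j x) (star (EvecNE γ j x)) +
        (γ : ℂ) ^ 2 • vecMulVec (EvecE j x) (star (EvecE j x)) := by
  have hx : x ≠ x + 1 := by fin_cases x <;> decide
  simp only [siteRho, sigmaE, if_neg hx, if_true]
  exact smul_add_smul_vecMulVec_mul_self _ _ (EvecNE_dotProduct_self hγ0 hγ1 j x)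
    (EvecE_dotProduct_self j x) (EvecNE_dotProduct_EvecE γ j x) (EvecE_dotProduct_EvecNE γ j x)

theorem sum_siteRho_mul_self {γ : ℝ} (hγ0 : 0 ≤ γ) (hγ1 : γ ≤ 2 / 3) (j : Fin 3) :
    ∑ x, (1 / 4 : ℂ) • (siteRho γ j x * siteRho γ j x) =
      Matrix.diagonal fun a => (siteLam γ j a : ℂ) := by
  have hNE := sum_vecMulVec_EvecNE hγ0 hγ1 j
  simp only [siteRho_mul_self hγ0 hγ1, smul_add, Finset.sum_add_distrib, sq, mul_smul,
    ← Finset.smul_sum] at hNE ⊢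
  rw [hNE, sum_vecMulVec_EvecE]
  simp only [← Matrix.diagonal_smul, Matrix.diagonal_add]
  congr 1
  ext a
  fin_cases j <;> fin_cases a <;> simp [siteLam, idx_zero, idx_one, idx_two] <;> ring

/-- Lemma 4 of the paper: `Σ_x 2^{−2n} (ρ^E_{j,x})²` is diagonal in the product
basis `{|g⟩ : g ∈ {0,1,2,3}^n}`, with eigenvalues `λ_g(j)`. -/
theorem stmt5 (γ : ℝ) (hγ0 : 0 ≤ γ) (hγ1 : γ ≤ 2 / 3) (n : ℕ) (j : Fin n → Fin 3) :
    ∑ x : Fin n → Fin 2,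
        ((1 / 2 ^ (2 * n) : ℝ) : ℂ) • (rhoE γ j x * rhoE γ j x)
      = Matrix.diagonal fun g => ((lam γ g j : ℝ) : ℂ) := by
  have hc : ((1 / 2 ^ (2 * n) : ℝ) : ℂ) = (1 / 4 : ℂ) ^ n := by
    push_cast
    rw [pow_mul, _root_.one_div_pow]
    norm_num
  have hx (x : Fin n → Fin 2) : ((1 / 2 ^ (2 * n) : ℝ) : ℂ) • (rhoE γ j x * rhoE γ j x) =
      tensorPow fun i => (1 / 4 : ℂ) • (siteRho γ (j i) (x i) * siteRho γ (j i) (x i)) := by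
    rw [hc, tensorPow_smul, ← tensorPow_mul]
    rfl
  simp only [hx, lam_eq_prod_siteLam, Complex.ofReal_prod]
  rw [sum_tensorPow fun i y => (1 / 4 : ℂ) • (siteRho γ (j i) y * siteRho γ (j i) y)]
  simp only [sum_siteRho_mul_self hγ0 hγ1, tensorPow_diagonal]
end

section
/- For every n ∈ ℕ with n ≥ 1 and every α > 0, Σ_{(τ₀,τ₁,τ₂,τ₃) ∈ 𝒯} ( n! / (τ₀!·τ₁!·τ₂!·τ₃!) ) · (1−(3/2)γ)^{τ₀} · (γ/2)^{τ₁+τ₂+τ₃} > 1 − 16·e^{−α²/2}. -/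
/-- Membership in the set `𝒯` of tallies lying in an `α`-neighborhood of
`m = (n(1−(3/2)γ), nγ/2, nγ/2, nγ/2)`. -/
def memT (γ α : ℝ) (n : ℕ) (τ : ℕ × ℕ × ℕ × ℕ) : Prop :=
  τ.1 + τ.2.1 + τ.2.2.1 + τ.2.2.2 = n ∧
    |(τ.1 : ℝ) - n * (1 - 3 / 2 * γ)| + |(τ.2.1 : ℝ) - n * (γ / 2)|
        + |(τ.2.2.1 : ℝ) - n * (γ / 2)| + |(τ.2.2.2 : ℝ) - n * (γ / 2)|
      < α * Real.sqrt n

open scoped Classical in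
/-- The set `𝒯` as a finite set of 4-tuples of naturals (any tuple of naturals
summing to `n` has all entries `≤ n`). -/
noncomputable def Tset (γ α : ℝ) (n : ℕ) : Finset (ℕ × ℕ × ℕ × ℕ) :=
  (Finset.range (n + 1) ×ˢ Finset.range (n + 1) ×ˢ Finset.range (n + 1)
      ×ˢ Finset.range (n + 1)).filter (memT γ α n)

open Finset in
/-- Hoeffding's lemma for a finitely supported distribution on `[-1, 1]`. -/
theorem sum_mul_exp_sub_le {ι : Type*} [Fintype ι] {p s : ι → ℝ} (hp : ∀ i, 0 ≤ p i)
    (hp1 : ∑ i, p i = 1) (hs : ∀ i, s i ∈ Set.Icc (-1 : ℝ) 1) (t : ℝ) :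
    ∑ i, p i * Real.exp (t * (s i - ∑ j, p j * s j)) ≤ Real.exp (t ^ 2 / 2) := by
  let _ : MeasurableSpace ι := ⊤
  have hq : ∑ i, ENNReal.ofReal (p i) = 1 := by
    rw [← ENNReal.ofReal_sum_of_nonneg fun i _ => hp i, hp1, ENNReal.ofReal_one]
  let q : PMF ι := PMF.ofFintype (fun i => ENNReal.ofReal (p i)) hq
  have hint : ∀ f : ι → ℝ, ∫ i, f i ∂q.toMeasure = ∑ i, p i * f i := fun f => by
    rw [PMF.integral_eq_sum]
    simp [q, ENNReal.toReal_ofReal, hp]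
  have h := (ProbabilityTheory.hasSubgaussianMGF_of_mem_Icc (μ := q.toMeasure) (X := s)
    (measurable_from_top.aemeasurable) (Filter.Eventually.of_forall hs)).mgf_le t
  rw [ProbabilityTheory.mgf, hint, hint] at h
  convert h using 2
  norm_num

open Finset in
/-- The `ℓ¹` concentration bound for the multinomial distribution. -/
theorem sum_multinomial_l1_deviation_lt {ι : Type*} [Fintype ι] [DecidableEq ι] {p : ι → ℝ}
    (hp : ∀ i, 0 ≤ p i) (hp1 : ∑ i, p i = 1) {n : ℕ} (hn : 1 ≤ n) {α : ℝ} (hα : 0 < α) :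
    ∑ k ∈ (piAntidiag univ n : Finset (ι → ℕ)) with ¬ ∑ i, |(k i : ℝ) - n * p i| < α * √n,
      (Nat.multinomial univ k * ∏ i, p i ^ k i : ℝ)
        < 2 ^ Fintype.card ι * Real.exp (-α ^ 2 / 2) := by
  have hn0 : (0 : ℝ) < √n := Real.sqrt_pos.2 (by exact_mod_cast hn)
  have hsq : √(n : ℝ) * √n = n := Real.mul_self_sqrt (Nat.cast_nonneg n)
  set t : ℝ := α / √n with ht
  have ht0 : 0 < t := by positivity
  have htα : t * (α * √n) = α ^ 2 := by rw [ht]; field_simp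
  have htn : n * (t ^ 2 / 2) = α ^ 2 / 2 := by
    rw [← hsq, ht]; field_simp
  let ε : (ι → ℤˣ) → ι → ℝ := fun e i => ((e i : ℤ) : ℝ)
  let w : (ι → ℕ) → ℝ := fun k => Nat.multinomial univ k * ∏ i, p i ^ k i
  have hw : ∀ k, 0 ≤ w k := fun k =>
    mul_nonneg (Nat.cast_nonneg _) (prod_nonneg fun i _ => pow_nonneg (hp i) _)
  let E : (ι → ℤˣ) → (ι → ℕ) → ℝ := fun e k =>
    Real.exp (t * ∑ i, ε e i * (k i - n * p i) - α ^ 2)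
  have hE : ∀ e k, 0 < E e k := fun e k => Real.exp_pos _
  have hbad : ∀ k : ι → ℕ, ¬ ∑ i, |(k i : ℝ) - n * p i| < α * √n → 1 ≤ ∑ e, E e k := by
    intro k hk
    let e : ι → ℤˣ := fun i => if 0 ≤ (k i : ℝ) - n * p i then 1 else -1
    refine le_trans ?_ (single_le_sum (fun e _ => (hE e k).le) (mem_univ e))
    have he : ∑ i, ε e i * (k i - n * p i) = ∑ i, |(k i : ℝ) - n * p i| := by
      refine sum_congr rfl fun i _ => ?_
      simp only [ε, e]
      split_ifs with h
      · simp [abs_of_nonneg h]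
      · rw [abs_of_neg (not_le.1 h)]; simp
    rw [Real.one_le_exp_iff, he, ← htα, ← mul_sub]
    exact mul_nonneg ht0.le (sub_nonneg.2 (not_lt.1 hk))
  have hmgf : ∀ e, ∑ k ∈ piAntidiag univ n, w k * E e k =
      (∑ i, p i * Real.exp (t * (ε e i - ∑ j, p j * ε e j))) ^ n * Real.exp (-α ^ 2) := by
    intro e
    rw [sum_pow_eq_sum_piAntidiag, sum_mul]
    refine sum_congr rfl fun k hk => ?_
    have hk : ∑ i, (k i : ℝ) = n := by exact_mod_cast (mem_piAntidiag.1 hk).1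
    simp only [w, E, mul_pow, prod_mul_distrib, mul_assoc]
    congr 2
    simp only [← Real.exp_nat_mul]
    rw [← Real.exp_sum, ← Real.exp_add]
    congr 1
    have : ∑ i, (k i : ℝ) * (t * (ε e i - ∑ j, p j * ε e j)) =
        t * (∑ i, ε e i * k i - (∑ i, (k i : ℝ)) * ∑ j, p j * ε e j) := by
      rw [sum_mul, ← sum_sub_distrib, mul_sum]
      exact sum_congr rfl fun i _ => by ring
    rw [this, hk, sub_eq_add_neg (t * _), mul_sum univ _ (n : ℝ), ← sum_sub_distrib]
    congr 2
    exact sum_congr rfl fun i _ => by ring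
  have hsplit : Real.exp (α ^ 2 / 2) * Real.exp (-α ^ 2) = Real.exp (-α ^ 2 / 2) := by
    rw [← Real.exp_add]; ring_nf
  have hle : ∀ e, ∑ k ∈ piAntidiag univ n, w k * E e k ≤ Real.exp (-α ^ 2 / 2) := by
    intro e
    rw [hmgf, ← hsplit, ← htn, Real.exp_nat_mul]
    gcongr
    · exact sum_nonneg fun i _ => mul_nonneg (hp i) (Real.exp_pos _).le
    · refine sum_mul_exp_sub_le hp hp1 (fun i => ?_) t
      rcases Int.units_eq_one_or (e i) with h | h <;> simp [ε, h]
  have hlt : ∑ k ∈ piAntidiag univ n, w k * E 1 k < Real.exp (-α ^ 2 / 2) := by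
    rw [hmgf]
    simp only [ε, Pi.one_apply, Units.val_one, Int.cast_one, mul_one, hp1, sub_self, mul_zero,
      Real.exp_zero, one_pow, one_mul]
    exact Real.exp_lt_exp.2 (by nlinarith [pow_pos hα 2])
  calc ∑ k ∈ piAntidiag univ n with ¬ ∑ i, |(k i : ℝ) - n * p i| < α * √n, w k
      ≤ ∑ k ∈ piAntidiag univ n with ¬ ∑ i, |(k i : ℝ) - n * p i| < α * √n,
          w k * ∑ e, E e k :=
        sum_le_sum fun k hk => le_mul_of_one_le_right (hw k) (hbad k (mem_filter.1 hk).2)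
    _ ≤ ∑ k ∈ piAntidiag univ n, w k * ∑ e, E e k :=
        sum_le_sum_of_subset_of_nonneg (filter_subset _ _) fun k _ _ =>
          mul_nonneg (hw k) (sum_nonneg fun e _ => (hE e k).le)
    _ = ∑ e, ∑ k ∈ piAntidiag univ n, w k * E e k := by
        simp only [mul_sum]; exact sum_comm
    _ < ∑ _e : ι → ℤˣ, Real.exp (-α ^ 2 / 2) :=
        sum_lt_sum (fun e _ => hle e) ⟨1, mem_univ _, hlt⟩
    _ = 2 ^ Fintype.card ι * Real.exp (-α ^ 2 / 2) := by
        simp [Fintype.card_pi]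

open Finset in
/-- The `ℓ¹` concentration bound for the multinomial distribution, in complementary form. -/
theorem lt_sum_multinomial_l1_near {ι : Type*} [Fintype ι] [DecidableEq ι] {p : ι → ℝ}
    (hp : ∀ i, 0 ≤ p i) (hp1 : ∑ i, p i = 1) {n : ℕ} (hn : 1 ≤ n) {α : ℝ} (hα : 0 < α) :
    1 - 2 ^ Fintype.card ι * Real.exp (-α ^ 2 / 2) <
      ∑ k ∈ (piAntidiag univ n : Finset (ι → ℕ)) with ∑ i, |(k i : ℝ) - n * p i| < α * √n,
        (Nat.multinomial univ k * ∏ i, p i ^ k i : ℝ) := by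
  have htotal := sum_pow_eq_sum_piAntidiag (univ : Finset ι) p n
  rw [hp1, one_pow, ← sum_filter_add_sum_filter_not _
    (fun k : ι → ℕ => ∑ i, |(k i : ℝ) - n * p i| < α * √n)] at htotal
  linarith [sum_multinomial_l1_deviation_lt hp hp1 hn hα]

/-- Equation (23) of the paper: the multinomial mass of the set `𝒯`
is larger than `1 − 16 e^{−α²/2}`. -/
theorem stmt11 (γ : ℝ) (hγ0 : 0 ≤ γ) (hγ1 : γ ≤ 2 / 3) (n : ℕ) (hn : 1 ≤ n)
    (α : ℝ) (hα : 0 < α) :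
    1 - 16 * Real.exp (-α ^ 2 / 2)
      < ∑ τ ∈ Tset γ α n,
          (n.factorial : ℝ) / ((τ.1.factorial : ℝ) * (τ.2.1.factorial : ℝ)
              * (τ.2.2.1.factorial : ℝ) * (τ.2.2.2.factorial : ℝ))
            * (1 - 3 / 2 * γ) ^ τ.1 * (γ / 2) ^ (τ.2.1 + τ.2.2.1 + τ.2.2.2) := by
  have hp : ∀ i, 0 ≤ (![1 - 3 / 2 * γ, γ / 2, γ / 2, γ / 2] : Fin 4 → ℝ) i := by
    intro i
    fin_cases i <;> simp <;> linarith
  have hp1 : ∑ i, (![1 - 3 / 2 * γ, γ / 2, γ / 2, γ / 2] : Fin 4 → ℝ) i = 1 := by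
    simp [Fin.sum_univ_four]; ring
  have h := lt_sum_multinomial_l1_near hp hp1 hn hα
  rw [Fintype.card_fin, show (2 : ℝ) ^ 4 = 16 by norm_num] at h
  refine h.trans_eq ?_
  refine Finset.sum_bij' (fun k _ => (k 0, k 1, k 2, k 3))
    (fun τ _ => ![τ.1, τ.2.1, τ.2.2.1, τ.2.2.2]) ?_ ?_ ?_ ?_ ?_
  · intro k hk
    simp only [Finset.mem_filter, Finset.mem_piAntidiag, Fin.sum_univ_four] at hk
    obtain ⟨⟨hsum, -⟩, hdev⟩ := hk
    simp only [Tset, memT, Finset.mem_filter, Finset.mem_product, Finset.mem_range]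
    exact ⟨by omega, hsum, by simpa using hdev⟩
  · intro τ hτ
    simp only [Tset, memT, Finset.mem_filter] at hτ
    simp only [Finset.mem_filter, Finset.mem_piAntidiag, Fin.sum_univ_four]
    exact ⟨⟨hτ.2.1, by simp⟩, by simpa using hτ.2.2⟩
  · intro k _
    ext i
    fin_cases i <;> rfl
  · intro τ _
    rfl
  · intro k hk
    have hsum := (Finset.mem_piAntidiag.1 (Finset.mem_filter.1 hk).1).1
    have hspec := Nat.multinomial_spec Finset.univ k
    rw [hsum] at hspec
    have hmult : (Nat.multinomial Finset.univ k : ℝ) = n.factorial /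
        ((k 0).factorial * (k 1).factorial * (k 2).factorial * (k 3).factorial) := by
      rw [← hspec, Fin.prod_univ_four]
      push_cast
      field_simp
    rw [hmult, Fin.prod_univ_four]
    simp
    ring
end

section
/- Assume 0 < γ ≤ 1/2, n ≥ 1 and α > 0. Then for every (τ₀,τ₁,τ₂,τ₃) ∈ 𝒯, ( (1−γ)^{τ₀+τ₁} · γ^{n−τ₀−τ₁} ) / ( (1−(3/2)γ)^{τ₀} · (γ/2)^{τ₁+τ₂+τ₃} ) ≤ 2^{ n·h(1−(3/2)γ, γ/2, γ/2, γ/2) − n·h(γ) } · ( 2(1−(3/2)γ)/γ )^{α√n/2}. -/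
/-- The binary entropy function `h(p) = p log₂(1/p) + (1−p) log₂(1/(1−p))`. -/
noncomputable def binEnt (p : ℝ) : ℝ :=
  p * Real.logb 2 (1 / p) + (1 - p) * Real.logb 2 (1 / (1 - p))

/-- The entropy `h(p₀,p₁,p₂,p₃) = Σ_i p_i log₂(1/p_i)`. -/
noncomputable def ent4 (p₀ p₁ p₂ p₃ : ℝ) : ℝ :=
  p₀ * Real.logb 2 (1 / p₀) + p₁ * Real.logb 2 (1 / p₁)
    + p₂ * Real.logb 2 (1 / p₂) + p₃ * Real.logb 2 (1 / p₃)

/-- A linear form evaluated at a vector with coordinate sum zero is at most half the spread of its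
coefficients times the `ℓ¹` norm of the vector. -/
theorem sum_mul_le_half_spread_mul_sum_abs {ι : Type*} (s : Finset ι) (a d : ι → ℝ) {l u : ℝ}
    (hl : ∀ i ∈ s, l ≤ a i) (hu : ∀ i ∈ s, a i ≤ u) (hd : ∑ i ∈ s, d i = 0) :
    ∑ i ∈ s, a i * d i ≤ (u - l) / 2 * ∑ i ∈ s, |d i| := by
  have hc : ∑ i ∈ s, a i * d i = ∑ i ∈ s, (a i - (l + u) / 2) * d i := by
    simp only [sub_mul, Finset.sum_sub_distrib, ← Finset.mul_sum, hd, mul_zero, sub_zero]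
  rw [hc, Finset.mul_sum]
  refine Finset.sum_le_sum fun i hi => (le_abs_self _).trans ?_
  rw [abs_mul]
  refine mul_le_mul_of_nonneg_right ?_ (abs_nonneg _)
  rw [abs_le]
  constructor <;> linarith [hl i hi, hu i hi]

/-- The maximisation step in the proof of Theorem 6: for every tally in `𝒯`,
the ratio appearing under the square root is bounded by
`2^{n h(1−(3/2)γ, γ/2, γ/2, γ/2) − n h(γ)} (2(1−(3/2)γ)/γ)^{α√n/2}`. -/
theorem stmt12 (γ : ℝ) (hγ0 : 0 < γ) (hγ1 : γ ≤ 1 / 2) (n : ℕ) (hn : 1 ≤ n)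
    (α : ℝ) (hα : 0 < α) (τ : ℕ × ℕ × ℕ × ℕ) (hτ : τ ∈ Tset γ α n) :
    ((1 - γ) ^ (τ.1 + τ.2.1) * γ ^ (n - τ.1 - τ.2.1)) /
        ((1 - 3 / 2 * γ) ^ τ.1 * (γ / 2) ^ (τ.2.1 + τ.2.2.1 + τ.2.2.2))
      ≤ (2 : ℝ) ^ ((n : ℝ) * ent4 (1 - 3 / 2 * γ) (γ / 2) (γ / 2) (γ / 2)
              - (n : ℝ) * binEnt γ)
          * (2 * (1 - 3 / 2 * γ) / γ) ^ (α * Real.sqrt n / 2) := by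
  obtain ⟨t₀, t₁, t₂, t₃⟩ := τ
  classical
  rw [Tset, Finset.mem_filter] at hτ
  obtain ⟨hsum, hdev⟩ := hτ.2
  simp only at hsum hdev ⊢
  have h₁ : 0 < 1 - γ := by linarith
  have h₀ : 0 < 1 - 3 / 2 * γ := by linarith
  have h₃ : 0 < γ / 2 := by linarith
  have hsub : n - t₀ - t₁ = t₂ + t₃ := by omega
  have hn' : (n : ℝ) = t₀ + t₁ + t₂ + t₃ := by exact_mod_cast hsum.symm
  have hlog₃ : Real.log (γ / 2) = Real.log γ - Real.log 2 := Real.log_div hγ0.ne' two_ne_zero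
  have hbase : Real.log (2 * (1 - 3 / 2 * γ) / γ)
      = Real.log (1 - 3 / 2 * γ) - Real.log (γ / 2) := by
    rw [← Real.log_div h₀.ne' h₃.ne']
    congr 1
    field_simp
  have hle₀₁ : Real.log (1 - 3 / 2 * γ) ≤ Real.log (1 - γ) := Real.log_le_log h₀ (by linarith)
  have hleγ₁ : Real.log γ ≤ Real.log (1 - γ) := Real.log_le_log hγ0 (by linarith)
  have hle₁₀ : Real.log (1 - γ) ≤ Real.log 2 + Real.log (1 - 3 / 2 * γ) := by
    rw [← Real.log_mul two_ne_zero h₀.ne']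
    exact Real.log_le_log h₁ (by linarith)
  have hent : Real.log 2 * ((n : ℝ) * ent4 (1 - 3 / 2 * γ) (γ / 2) (γ / 2) (γ / 2)
        - (n : ℝ) * binEnt γ)
      = n * ((1 - γ) * Real.log (1 - γ) + γ * Real.log γ
        - (1 - 3 / 2 * γ) * Real.log (1 - 3 / 2 * γ) - 3 / 2 * γ * Real.log (γ / 2)) := by
    have hlog2 : Real.log 2 ≠ 0 := (Real.log_pos one_lt_two).ne'
    simp only [ent4, binEnt, Real.logb, one_div, Real.log_inv]
    field_simp
    ring
  have hspread := sum_mul_le_half_spread_mul_sum_abs Finset.univ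
    ![Real.log (1 - γ) - Real.log (1 - 3 / 2 * γ), Real.log (1 - γ) - Real.log (γ / 2),
      Real.log 2, Real.log 2]
    ![(t₀ : ℝ) - n * (1 - 3 / 2 * γ), (t₁ : ℝ) - n * (γ / 2), (t₂ : ℝ) - n * (γ / 2),
      (t₃ : ℝ) - n * (γ / 2)]
    (l := Real.log (1 - γ) - Real.log (1 - 3 / 2 * γ)) (u := Real.log (1 - γ) - Real.log (γ / 2))
    (by
      intro i _
      fin_cases i <;> simp <;> linarith)
    (by
      intro i _
      fin_cases i <;> simp <;> linarith)
    (by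
      simp [Fin.sum_univ_four]
      linarith)
  simp only [Fin.sum_univ_four, Matrix.cons_val] at hspread
  have hscale := mul_le_mul_of_nonneg_left hdev.le
    (show 0 ≤ (Real.log (1 - 3 / 2 * γ) - Real.log (γ / 2)) / 2 by linarith)
  have hR : 0 < 2 * (1 - 3 / 2 * γ) / γ := by positivity
  rw [hsub, ← Real.log_le_log_iff (by positivity) (by positivity),
    Real.log_div (by positivity) (by positivity), Real.log_mul (by positivity) (by positivity),
    Real.log_mul (by positivity) (by positivity), Real.log_mul (by positivity) (by positivity),
    Real.log_rpow two_pos, Real.log_rpow hR, hbase, mul_comm _ (Real.log 2), hent]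
  simp only [Real.log_pow]
  push_cast
  rw [hlog₃] at *
  linarith
end

section
/- Assume 0 < γ ≤ 1/2, n ≥ 1 and α > 0. Then Σ_{(τ₀,τ₁,τ₂,τ₃) ∈ 𝒯} ( n! / (τ₀!·τ₁!·τ₂!·τ₃!) ) · (√((1−γ)(1−(3/2)γ)))^{τ₀} · (√((γ/2)(1−γ)))^{τ₁} · (γ/√2)^{τ₂+τ₃} ≤ 2^{ (n/2)·h(1−(3/2)γ, γ/2, γ/2, γ/2) − (n/2)·h(γ) } · ( 2(1−(3/2)γ)/γ )^{α√n/4}. -/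
/-- A multinomial sum over any finite set of 4-tuples summing to `n` is at most the `n`-th power
of the sum of the (nonnegative) weights. -/
theorem sum_multinomial_four_le_pow (n : ℕ) (S : Finset (ℕ × ℕ × ℕ × ℕ))
    (hS : ∀ τ ∈ S, τ.1 + τ.2.1 + τ.2.2.1 + τ.2.2.2 = n) {a b c d : ℝ}
    (ha : 0 ≤ a) (hb : 0 ≤ b) (hc : 0 ≤ c) (hd : 0 ≤ d) :
    ∑ τ ∈ S, (n.factorial : ℝ) / ((τ.1.factorial : ℝ) * (τ.2.1.factorial : ℝ)
            * (τ.2.2.1.factorial : ℝ) * (τ.2.2.2.factorial : ℝ))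
          * (a ^ τ.1 * b ^ τ.2.1 * c ^ τ.2.2.1 * d ^ τ.2.2.2) ≤ (a + b + c + d) ^ n := by
  classical
  let f : ℕ × ℕ × ℕ × ℕ → Fin 4 → ℕ := fun τ => ![τ.1, τ.2.1, τ.2.2.1, τ.2.2.2]
  let x : Fin 4 → ℝ := ![a, b, c, d]
  have hx : ∀ i, 0 ≤ x i := by
    intro i
    fin_cases i <;> simpa [x]
  have hf : Function.Injective f := by
    rintro ⟨t₀, t₁, t₂, t₃⟩ ⟨s₀, s₁, s₂, s₃⟩ h
    simpa [f] using h
  have hpow := Finset.sum_pow_eq_sum_piAntidiag (Finset.univ : Finset (Fin 4)) x n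
  have hsum : ∑ i, x i = a + b + c + d := by simp [x, Fin.sum_univ_four]
  rw [← hsum, hpow]
  calc _ = ∑ τ ∈ S, (Nat.multinomial Finset.univ (f τ) : ℝ) * ∏ i, x i ^ f τ i := by
        refine Finset.sum_congr rfl fun τ hτ => ?_
        have hτn := hS τ hτ
        have hspec := Nat.multinomial_spec (Finset.univ : Finset (Fin 4)) (f τ)
        simp only [Fin.sum_univ_four, Fin.prod_univ_four] at hspec ⊢
        have h : (τ.1.factorial * τ.2.1.factorial * τ.2.2.1.factorial * τ.2.2.2.factorial)
            * Nat.multinomial Finset.univ (f τ) = n.factorial := by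
          rw [← hτn]
          exact hspec
        have hpos : (τ.1.factorial * τ.2.1.factorial * τ.2.2.1.factorial
            * τ.2.2.2.factorial : ℝ) ≠ 0 := by positivity
        have hdiv : (n.factorial : ℝ) / ((τ.1.factorial : ℝ) * (τ.2.1.factorial : ℝ)
            * (τ.2.2.1.factorial : ℝ) * (τ.2.2.2.factorial : ℝ))
            = (Nat.multinomial Finset.univ (f τ) : ℝ) := by
          rw [div_eq_iff hpos, ← h]
          push_cast
          ring
        rw [hdiv]
        rfl
    _ = ∑ k ∈ S.image f, (Nat.multinomial Finset.univ k : ℝ) * ∏ i, x i ^ k i :=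
        (Finset.sum_image (f := fun k => (Nat.multinomial Finset.univ k : ℝ) * ∏ i, x i ^ k i)
          fun _ _ _ _ h => hf h).symm
    _ ≤ _ := by
        refine Finset.sum_le_sum_of_subset_of_nonneg ?_ fun k _ _ =>
          mul_nonneg (Nat.cast_nonneg _) (Finset.prod_nonneg fun i _ => pow_nonneg (hx i) _)
        intro k hk
        obtain ⟨τ, hτ, rfl⟩ := Finset.mem_image.1 hk
        rw [Finset.mem_piAntidiag]
        exact ⟨by simpa [f, Fin.sum_univ_four] using hS τ hτ, by simp⟩

/-- Pairing a vector of total mass zero with coefficients lying in `[l, u]`. -/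
theorem pairing_le_of_sum_eq_zero {x₀ x₁ x₂ x₃ c₀ c₁ c₂ c₃ l u D : ℝ}
    (hx : x₀ + x₁ + x₂ + x₃ = 0) (hD : |x₀| + |x₁| + |x₂| + |x₃| ≤ D)
    (h₀ : l ≤ c₀ ∧ c₀ ≤ u) (h₁ : l ≤ c₁ ∧ c₁ ≤ u) (h₂ : l ≤ c₂ ∧ c₂ ≤ u)
    (h₃ : l ≤ c₃ ∧ c₃ ≤ u) :
    x₀ * c₀ + x₁ * c₁ + x₂ * c₂ + x₃ * c₃ ≤ (u - l) / 2 * D := by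
  have key : ∀ x c : ℝ, l ≤ c ∧ c ≤ u → x * (c - (l + u) / 2) ≤ |x| * ((u - l) / 2) := by
    rintro x c ⟨hl, hu⟩
    calc x * (c - (l + u) / 2) ≤ |x * (c - (l + u) / 2)| := le_abs_self _
      _ = |x| * |c - (l + u) / 2| := abs_mul _ _
      _ ≤ _ := by
        gcongr
        rw [abs_le]
        constructor <;> linarith
  have hmul : (|x₀| + |x₁| + |x₂| + |x₃|) * ((u - l) / 2) ≤ D * ((u - l) / 2) :=
    mul_le_mul_of_nonneg_right hD (by linarith [h₀.1, h₀.2])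
  have hmid : x₀ * c₀ + x₁ * c₁ + x₂ * c₂ + x₃ * c₃ = x₀ * (c₀ - (l + u) / 2)
      + x₁ * (c₁ - (l + u) / 2) + x₂ * (c₂ - (l + u) / 2) + x₃ * (c₃ - (l + u) / 2) := by
    linear_combination (l + u) / 2 * hx
  linarith [key x₀ c₀ h₀, key x₁ c₁ h₁, key x₂ c₂ h₂, key x₃ c₃ h₃]

theorem sqrt_mul_eq_mul_exp {p w : ℝ} (hp : 0 < p) (hw : 0 < w) :
    Real.sqrt (p * w) = p * Real.exp ((Real.log w - Real.log p) / 2) := by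
  rw [Real.sqrt_eq_iff_mul_self_eq (by positivity) (by positivity), eq_comm]
  have h : Real.exp ((Real.log w - Real.log p) / 2) * Real.exp ((Real.log w - Real.log p) / 2)
      = w / p := by
    rw [← Real.exp_add, add_halves, Real.exp_sub, Real.exp_log hw, Real.exp_log hp]
  calc _ = p * p * (Real.exp ((Real.log w - Real.log p) / 2)
        * Real.exp ((Real.log w - Real.log p) / 2)) := by ring
    _ = p * w := by
      rw [h]
      field_simp

theorem log_two_mul_ent4 (p₀ p₁ p₂ p₃ : ℝ) :
    Real.log 2 * ent4 p₀ p₁ p₂ p₃ = -(p₀ * Real.log p₀ + p₁ * Real.log p₁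
      + p₂ * Real.log p₂ + p₃ * Real.log p₃) := by
  have h2 : Real.log 2 ≠ 0 := (Real.log_pos one_lt_two).ne'
  simp only [ent4, Real.logb, one_div, Real.log_inv]
  field_simp
  ring

theorem log_two_mul_binEnt (p : ℝ) :
    Real.log 2 * binEnt p = -(p * Real.log p + (1 - p) * Real.log (1 - p)) := by
  have h2 : Real.log 2 ≠ 0 := (Real.log_pos one_lt_two).ne'
  simp only [binEnt, Real.logb, one_div, Real.log_inv]
  field_simp
  ring

/-- The bound on the smoothed multinomial sum (cf. equation (24) of the paper):
`Σ_{τ∈𝒯} (n!/(τ₀!τ₁!τ₂!τ₃!)) (√((1−γ)(1−(3/2)γ)))^{τ₀} (√((γ/2)(1−γ)))^{τ₁} (γ/√2)^{τ₂+τ₃}`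
is at most `2^{(n/2) h(1−(3/2)γ,γ/2,γ/2,γ/2) − (n/2) h(γ)} (2(1−(3/2)γ)/γ)^{α√n/4}`. -/
theorem stmt13 (γ : ℝ) (hγ0 : 0 < γ) (hγ1 : γ ≤ 1 / 2) (n : ℕ) (hn : 1 ≤ n)
    (α : ℝ) (hα : 0 < α) :
    ∑ τ ∈ Tset γ α n,
        (n.factorial : ℝ) / ((τ.1.factorial : ℝ) * (τ.2.1.factorial : ℝ)
            * (τ.2.2.1.factorial : ℝ) * (τ.2.2.2.factorial : ℝ))
          * Real.sqrt ((1 - γ) * (1 - 3 / 2 * γ)) ^ τ.1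
          * Real.sqrt ((γ / 2) * (1 - γ)) ^ τ.2.1
          * (γ / Real.sqrt 2) ^ (τ.2.2.1 + τ.2.2.2)
      ≤ (2 : ℝ) ^ ((n : ℝ) / 2 * ent4 (1 - 3 / 2 * γ) (γ / 2) (γ / 2) (γ / 2)
              - (n : ℝ) / 2 * binEnt γ)
          * (2 * (1 - 3 / 2 * γ) / γ) ^ (α * Real.sqrt n / 4) := by
  have hq : 0 < γ / 2 := by positivity
  have hp : 0 < 1 - 3 / 2 * γ := by linarith
  have hw : 0 < 1 - γ := by linarith
  have hqlog : Real.log (γ / 2) = Real.log γ - Real.log 2 :=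
    Real.log_div hγ0.ne' two_ne_zero
  have hRlog : Real.log (2 * (1 - 3 / 2 * γ) / γ)
      = Real.log 2 + Real.log (1 - 3 / 2 * γ) - Real.log γ := by
    rw [Real.log_div (by positivity) hγ0.ne', Real.log_mul two_ne_zero hp.ne']
  have hle₁ : Real.log γ ≤ Real.log (1 - γ) := Real.log_le_log hγ0 (by linarith)
  have hle₂ : Real.log (1 - γ) ≤ Real.log 2 + Real.log (1 - 3 / 2 * γ) := by
    rw [← Real.log_mul two_ne_zero hp.ne']
    exact Real.log_le_log hw (by linarith)
  have ha₀ := sqrt_mul_eq_mul_exp hp hw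
  have ha₁ := sqrt_mul_eq_mul_exp hq hw
  have ha₂ := sqrt_mul_eq_mul_exp hq hγ0
  have hsq : γ / Real.sqrt 2 = Real.sqrt (γ / 2 * γ) := by
    rw [show γ / 2 * γ = γ ^ 2 / 2 by ring, Real.sqrt_div (sq_nonneg γ), Real.sqrt_sq hγ0.le]
  rw [mul_comm (1 - γ), hsq, ha₀, ha₁, ha₂]
  have hent := log_two_mul_ent4 (1 - 3 / 2 * γ) (γ / 2) (γ / 2) (γ / 2)
  have hbin := log_two_mul_binEnt γ
  rw [Real.rpow_def_of_pos two_pos, Real.rpow_def_of_pos (by positivity), ← Real.exp_add, hRlog]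
  set E := Real.log 2 * ((n : ℝ) / 2 * ent4 (1 - 3 / 2 * γ) (γ / 2) (γ / 2) (γ / 2)
              - (n : ℝ) / 2 * binEnt γ)
      + (Real.log 2 + Real.log (1 - 3 / 2 * γ) - Real.log γ) * (α * Real.sqrt n / 4) with hE
  have hmem : ∀ τ ∈ Tset γ α n, memT γ α n τ := by
    intro τ hτ
    classical
    rw [Tset, Finset.mem_filter] at hτ
    exact hτ.2
  have hsum := sum_multinomial_four_le_pow n (Tset γ α n) (fun τ hτ => (hmem τ hτ).1)
    hp.le hq.le hq.le hq.le
  rw [show 1 - 3 / 2 * γ + γ / 2 + γ / 2 + γ / 2 = 1 by ring, one_pow] at hsum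
  refine le_trans ?_ (mul_le_of_le_one_left (Real.exp_pos E).le hsum)
  rw [Finset.sum_mul]
  refine Finset.sum_le_sum ?_
  rintro ⟨t₀, t₁, t₂, t₃⟩ hτ
  obtain ⟨htot, hdev⟩ := hmem _ hτ
  dsimp only at htot hdev ⊢
  have htot' : (t₀ : ℝ) + t₁ + t₂ + t₃ = n := by exact_mod_cast htot
  have hpair := pairing_le_of_sum_eq_zero
    (c₀ := Real.log (1 - γ) - Real.log (1 - 3 / 2 * γ))
    (c₁ := Real.log (1 - γ) - Real.log (γ / 2))
    (c₂ := Real.log γ - Real.log (γ / 2)) (c₃ := Real.log γ - Real.log (γ / 2))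
    (l := Real.log (1 - γ) - Real.log (1 - 3 / 2 * γ))
    (u := Real.log (1 - γ) - Real.log (γ / 2))
    (by linear_combination htot') hdev.le ⟨le_rfl, by linarith⟩ ⟨by linarith, le_rfl⟩
    ⟨by linarith, by linarith⟩ ⟨by linarith, by linarith⟩
  have hexp : t₀ * ((Real.log (1 - γ) - Real.log (1 - 3 / 2 * γ)) / 2)
      + t₁ * ((Real.log (1 - γ) - Real.log (γ / 2)) / 2)
      + (t₂ + t₃ : ℕ) * ((Real.log γ - Real.log (γ / 2)) / 2) ≤ E := by
    have hE' : E = n / 2 * (Real.log 2 * ent4 (1 - 3 / 2 * γ) (γ / 2) (γ / 2) (γ / 2))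
        - n / 2 * (Real.log 2 * binEnt γ)
        + (Real.log 2 + Real.log (1 - 3 / 2 * γ) - Real.log γ) * (α * Real.sqrt n / 4) := by
      rw [hE]
      ring
    rw [hE', hent, hbin]
    push_cast
    rw [hqlog] at hpair ⊢
    linarith
  rw [mul_pow, mul_pow, mul_pow, ← Real.exp_nat_mul, ← Real.exp_nat_mul, ← Real.exp_nat_mul]
  calc _ = (n.factorial : ℝ) / ((t₀.factorial : ℝ) * (t₁.factorial : ℝ)
            * (t₂.factorial : ℝ) * (t₃.factorial : ℝ))
          * ((1 - 3 / 2 * γ) ^ t₀ * (γ / 2) ^ t₁ * (γ / 2) ^ t₂ * (γ / 2) ^ t₃)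
          * Real.exp (t₀ * ((Real.log (1 - γ) - Real.log (1 - 3 / 2 * γ)) / 2)
            + t₁ * ((Real.log (1 - γ) - Real.log (γ / 2)) / 2)
            + (t₂ + t₃ : ℕ) * ((Real.log γ - Real.log (γ / 2)) / 2)) := by
        rw [Real.exp_add, Real.exp_add, pow_add]
        ring
    _ ≤ _ := by gcongr
end
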